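/- Let a ∈ (−1, 1/3) with a ≠ 0, and let z(θ) = a·ζ(θ)/((2cos θ + ζ(θ))(1 + 2ζ(θ)cos θ)) with ζ(θ) = ((2a − 1)cos θ + √((1 − 4a)cos²θ + a)) / (1 − 4a·cos²θ). Then z maps the interval (2π/3, π) onto the interior of I_a = (−∞, (−2 + 9a − 2√((1 − 3a)³))/27]; in particular z(θ) → −∞ as θ → (2π/3)⁺ and z(θ) → (−2 + 9a − 2√((1 − 3a)³))/27 as θ → π⁻. -/

import Mathlib

open Filter Topology

/-- `ζ(θ)` from the paper. -/
noncomputable def zetaFn (a θ : ℝ) : ℝ :=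
  ((2 * a - 1) * Real.cos θ + Real.sqrt ((1 - 4 * a) * Real.cos θ ^ 2 + a)) /
    (1 - 4 * a * Real.cos θ ^ 2)

/-- auxiliary root function -/
noncomputable def sAux (a θ : ℝ) : ℝ :=
  2 * Real.cos θ * (Real.cos θ - Real.sqrt ((1 - 4 * a) * Real.cos θ ^ 2 + a)) /
    (4 * Real.cos θ ^ 2 - 1)

lemma cos_two_pi_third : Real.cos (2 * Real.pi / 3) = -(1/2) := by
  rw [show 2 * Real.pi / 3 = Real.pi - Real.pi / 3 by ring, Real.cos_pi_sub, Real.cos_pi_div_three]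

lemma cos_range {θ : ℝ} (h : θ ∈ Set.Ioo (2 * Real.pi / 3) Real.pi) :
    -1 < Real.cos θ ∧ Real.cos θ < -(1/2) := by
  have hp := Real.pi_pos
  constructor
  · rw [← Real.cos_pi]
    exact Real.cos_lt_cos_of_nonneg_of_le_pi (by linarith [h.1]) le_rfl h.2
  · rw [← cos_two_pi_third]
    exact Real.cos_lt_cos_of_nonneg_of_le_pi (by linarith) h.2.le h.1

lemma s_gt (a c S r : ℝ) (hc1 : -1 < c) (hc2 : c < -(1/2)) (hS : 0 ≤ S)
    (hS2 : S ^ 2 = (1 - 4 * a) * c ^ 2 + a) (hr : 0 < r) (hr2 : r ^ 2 = 1 - 3 * a) :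
    2 * (r + 1) / 3 < 2 * c * (c - S) / (4 * c ^ 2 - 1) := by
  have hE : 0 < 4 * c ^ 2 - 1 := by nlinarith
  set s := 2 * c * (c - S) / (4 * c ^ 2 - 1) with hs
  have hsE : s * (4 * c ^ 2 - 1) = 2 * c * (c - S) := by
    rw [hs, div_mul_cancel₀ _ hE.ne']
  have h1 : 2 / 3 < s := by
    rw [hs, lt_div_iff₀ hE]; nlinarith
  have hc0 : 0 < c ^ 2 := by nlinarith
  have h2 : s ^ 2 * (4 * c ^ 2 - 1) = 4 * c ^ 2 * (s - a) := by
    have : (4 * c ^ 2 - 1) * (s ^ 2 * (4 * c ^ 2 - 1)) = (4 * c ^ 2 - 1) * (4 * c ^ 2 * (s - a)) := by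
      linear_combination (s * (4 * c ^ 2 - 1) + 2 * c * (c - S) - 4 * c^2) * hsE + 4 * c ^ 2 * hS2
    exact mul_left_cancel₀ hE.ne' this
  have h3 : 0 < 3 * s ^ 2 - 4 * s + 4 * a := by
    have : 0 < (3 * s ^ 2 - 4 * s + 4 * a) * c ^ 2 := by
      have : (3 * s ^ 2 - 4 * s + 4 * a) * c ^ 2 = s ^ 2 * (1 - c ^ 2) := by linear_combination h2
      rw [this]
      have : 0 < 1 - c ^ 2 := by nlinarith
      positivity
    exact pos_of_mul_pos_left this hc0.le
  nlinarith

lemma formula_aux (a c S : ℝ) (ha0 : a ≠ 0) (hc1 : -1 < c) (hc2 : c < -(1/2)) (hS : 0 ≤ S)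
    (hS2 : S ^ 2 = (1 - 4 * a) * c ^ 2 + a) (hD : 1 - 4 * a * c ^ 2 ≠ 0) (ζ s : ℝ)
    (hζ : ζ = ((2 * a - 1) * c + S) / (1 - 4 * a * c ^ 2))
    (hs : s = 2 * c * (c - S) / (4 * c ^ 2 - 1)) :
    (1 - s) * (s ^ 2 - s + a) = a * ζ / ((2 * c + ζ) * (1 + 2 * ζ * c)) := by
  have hE : 0 < 4 * c ^ 2 - 1 := by nlinarith
  have hcS : c - S ≠ 0 := by linarith
  obtain ⟨u, hu⟩ : ∃ u, u = (S + c) / a := ⟨_, rfl⟩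
  have hua : u * a = S + c := by rw [hu]; field_simp
  have hucs : u * (c - S) = 4 * c ^ 2 - 1 := by
    apply mul_left_cancel₀ ha0
    linear_combination (c - S) * hua - hS2
  have hu0 : u ≠ 0 := by
    rintro rfl; linarith
  have hq : a * u ^ 2 = 2 * c * u + 1 - 4 * c ^ 2 := by
    linear_combination u * hua - hucs
  have hs' : s = 2 * c / u := by
    rw [hs, ← hucs]; field_simp
  have hw : ((2 * a - 1) * c + S) * (u - 2 * c) = 1 - 4 * a * c ^ 2 := by
    apply mul_left_cancel₀ ha0
    linear_combination ((2 * a - 1) * c + S) * hua + hS2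
  have hw0 : u - 2 * c ≠ 0 := by
    intro h; rw [h] at hw; apply hD; linarith
  have hζ' : ζ = 1 / (u - 2 * c) := by
    rw [hζ, div_eq_div_iff hD hw0]; linarith
  have e1 : 2 * c + ζ = a * u ^ 2 / (u - 2 * c) := by
    rw [hζ', hq]; field_simp; ring
  have e2 : 1 + 2 * ζ * c = u / (u - 2 * c) := by
    rw [hζ']; field_simp; ring
  have e3 : s ^ 2 - s + a = 1 / u ^ 2 := by
    rw [hs']; field_simp; linarith
  rw [e1, e2, e3, hs', hζ']
  field_simp

lemma rad_pos (a c : ℝ) (ha : a < 1/3) (hc1 : -1 ≤ c) (hc2 : c ≤ -(1/2)) :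
    0 ≤ (1 - 4 * a) * c ^ 2 + a := by
  have h1 : c ^ 2 ≤ 1 := by nlinarith
  have h2 : 1/4 ≤ c ^ 2 := by nlinarith
  nlinarith [mul_nonneg (sub_nonneg.2 h2) (sub_nonneg.2 ha.le)]

/-- For `a ∈ (-1, 1/3)`, `a ≠ 0`, the function `z(θ)` (continuously extended) maps
`(2π/3, π)` onto the interior of `I_a`; in particular `z(θ) → -∞` as `θ → (2π/3)⁺`
and `z(θ) → (-2 + 9a - 2√((1 - 3a)³))/27` as `θ → π⁻`. -/
theorem stmt_12 (a : ℝ) (ha : a ∈ Set.Ioo (-1 : ℝ) (1 / 3)) (ha0 : a ≠ 0) :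
    ∃ Z : ℝ → ℝ, ContinuousOn Z (Set.Ioo (2 * Real.pi / 3) Real.pi) ∧
      (∀ θ ∈ Set.Ioo (2 * Real.pi / 3) Real.pi, 1 - 4 * a * Real.cos θ ^ 2 ≠ 0 →
        Z θ = a * zetaFn a θ /
          ((2 * Real.cos θ + zetaFn a θ) * (1 + 2 * zetaFn a θ * Real.cos θ))) ∧
      Z '' Set.Ioo (2 * Real.pi / 3) Real.pi =
        Set.Iio ((-2 + 9 * a - 2 * Real.sqrt ((1 - 3 * a) ^ 3)) / 27) ∧
      Tendsto Z (nhdsWithin (2 * Real.pi / 3) (Set.Ioi (2 * Real.pi / 3))) atBot ∧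
      Tendsto Z (nhdsWithin Real.pi (Set.Iio Real.pi))
        (nhds ((-2 + 9 * a - 2 * Real.sqrt ((1 - 3 * a) ^ 3)) / 27)) := by
  obtain ⟨ha1, ha2⟩ := ha
  have hp := Real.pi_pos
  have hab : 2 * Real.pi / 3 < Real.pi := by linarith
  obtain ⟨r, hr⟩ : ∃ r, r = Real.sqrt (1 - 3 * a) := ⟨_, rfl⟩
  have hr0 : 0 < r := by rw [hr]; exact Real.sqrt_pos.2 (by linarith)
  have hr2 : r ^ 2 = 1 - 3 * a := by rw [hr]; exact Real.sq_sqrt (by linarith)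
  have hr3 : Real.sqrt ((1 - 3 * a) ^ 3) = r ^ 3 := by
    rw [← hr2, show (r ^ 2) ^ 3 = (r ^ 3) ^ 2 by ring]
    exact Real.sqrt_sq (by positivity)
  rw [hr3]
  have haa : a = (1 - r ^ 2) / 3 := by linarith
  have hnum : Continuous fun θ : ℝ =>
      2 * Real.cos θ * (Real.cos θ - Real.sqrt ((1 - 4 * a) * Real.cos θ ^ 2 + a)) := by fun_prop
  have hden : Continuous fun θ : ℝ => 4 * Real.cos θ ^ 2 - 1 := by fun_prop
  have hE : ∀ θ ∈ Set.Ioo (2 * Real.pi / 3) Real.pi, 0 < 4 * Real.cos θ ^ 2 - 1 := by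
    intro θ hθ
    obtain ⟨h1, h2⟩ := cos_range hθ
    nlinarith
  have hscont : ContinuousOn (sAux a) (Set.Ioo (2 * Real.pi / 3) Real.pi) :=
    hnum.continuousOn.div hden.continuousOn fun θ hθ => (hE θ hθ).ne'
  have hZcont : ContinuousOn (fun θ => (1 - sAux a θ) * (sAux a θ ^ 2 - sAux a θ + a))
      (Set.Ioo (2 * Real.pi / 3) Real.pi) := by fun_prop
  have hsq : ∀ θ ∈ Set.Ioo (2 * Real.pi / 3) Real.pi,
      Real.sqrt ((1 - 4 * a) * Real.cos θ ^ 2 + a) ^ 2 = (1 - 4 * a) * Real.cos θ ^ 2 + a := by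
    intro θ hθ
    obtain ⟨h1, h2⟩ := cos_range hθ
    exact Real.sq_sqrt (rad_pos a _ ha2 h1.le h2.le)
  have hleft : 𝓝[>] (2 * Real.pi / 3) ≤ 𝓟 (Set.Ioo (2 * Real.pi / 3) Real.pi) :=
    le_principal_iff.2 (Ioo_mem_nhdsGT hab)
  have hright : 𝓝[<] Real.pi ≤ 𝓟 (Set.Ioo (2 * Real.pi / 3) Real.pi) :=
    le_principal_iff.2 (Ioo_mem_nhdsLT hab)
  have hsInfty : Tendsto (sAux a) (𝓝[>] (2 * Real.pi / 3)) atTop := by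
    have h1 : Tendsto (fun θ : ℝ => 2 * Real.cos θ * (Real.cos θ -
        Real.sqrt ((1 - 4 * a) * Real.cos θ ^ 2 + a))) (𝓝[>] (2 * Real.pi / 3)) (𝓝 1) := by
      have := (hnum.tendsto (2 * Real.pi / 3)).mono_left (nhdsWithin_le_nhds (s := Set.Ioi (2 * Real.pi / 3)))
      convert this using 2
      rw [cos_two_pi_third, show (1 - 4 * a) * (-(1/2)) ^ 2 + a = (1/2 : ℝ) ^ 2 by ring,
        Real.sqrt_sq (by norm_num)]
      norm_num
    have h2 : Tendsto (fun θ : ℝ => 4 * Real.cos θ ^ 2 - 1) (𝓝[>] (2 * Real.pi / 3)) (𝓝[>] 0) := by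
      rw [tendsto_nhdsWithin_iff]
      constructor
      · have := (hden.tendsto (2 * Real.pi / 3)).mono_left (nhdsWithin_le_nhds (s := Set.Ioi (2 * Real.pi / 3)))
        convert this using 2
        rw [cos_two_pi_third]; norm_num
      · filter_upwards [Ioo_mem_nhdsGT hab] with θ hθ using hE θ hθ
    exact h1.pos_mul_atTop one_pos h2.inv_tendsto_nhdsGT_zero
  have hbot : Tendsto (fun θ => (1 - sAux a θ) * (sAux a θ ^ 2 - sAux a θ + a))
      (𝓝[>] (2 * Real.pi / 3)) atBot := by
    have h1 : Tendsto (fun x : ℝ => 1 - x) atTop atBot :=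
      tendsto_atBot_mono (fun x => by simp only [Function.comp, id]; linarith) (tendsto_neg_atTop_atBot.comp
        (tendsto_atTop_add_const_right atTop (-1 : ℝ) tendsto_id) |>.congr fun x => rfl)
    have h2 : Tendsto (fun x : ℝ => x ^ 2 - x + a) atTop atTop :=
      tendsto_atTop_mono (fun x => by simp only [id]; nlinarith [sq_nonneg (x - 1)])
        (tendsto_atTop_add_const_right atTop (a - 1 : ℝ) tendsto_id)
    exact (h1.comp hsInfty).atBot_mul_atTop₀ (h2.comp hsInfty)
  have hlim : Tendsto (fun θ => (1 - sAux a θ) * (sAux a θ ^ 2 - sAux a θ + a))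
      (𝓝[<] Real.pi) (𝓝 ((-2 + 9 * a - 2 * r ^ 3) / 27)) := by
    have hs : ContinuousAt (sAux a) Real.pi :=
      hnum.continuousAt.div hden.continuousAt (by rw [Real.cos_pi]; norm_num)
    have hv : sAux a Real.pi = 2 * (r + 1) / 3 := by
      unfold sAux
      rw [Real.cos_pi, show (1 - 4 * a) * (-1) ^ 2 + a = 1 - 3 * a by ring, ← hr]
      ring
    have hc : ContinuousAt (fun θ => (1 - sAux a θ) * (sAux a θ ^ 2 - sAux a θ + a)) Real.pi := by
      fun_prop
    have := hc.tendsto.mono_left (nhdsWithin_le_nhds (s := Set.Iio Real.pi))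
    convert this using 2
    rw [hv, haa]; ring
  refine ⟨fun θ => (1 - sAux a θ) * (sAux a θ ^ 2 - sAux a θ + a), hZcont, ?_, ?_, hbot, hlim⟩
  · intro θ hθ hD
    obtain ⟨h1, h2⟩ := cos_range hθ
    exact formula_aux a _ _ ha0 h1 h2 (Real.sqrt_nonneg _) (hsq θ hθ) hD _ _ rfl rfl
  · apply Set.Subset.antisymm
    · rintro _ ⟨θ, hθ, rfl⟩
      obtain ⟨h1, h2⟩ := cos_range hθ
      have h := s_gt a _ _ r h1 h2 (Real.sqrt_nonneg _) (hsq θ hθ) hr0 hr2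
      change 2 * (r + 1) / 3 < sAux a θ at h
      rw [Set.mem_Iio, ← sub_pos]
      have e : (-2 + 9 * a - 2 * r ^ 3) / 27 - (1 - sAux a θ) * (sAux a θ ^ 2 - sAux a θ + a)
          = (sAux a θ - 2 * (r + 1) / 3) * (sAux a θ - (2 - r) / 3) ^ 2 := by
        generalize sAux a θ = s
        rw [haa]; ring
      rw [e]
      have h4 : 0 < sAux a θ - (2 - r) / 3 := by linarith
      have h5 : 0 < sAux a θ - 2 * (r + 1) / 3 := by linarith
      positivity
    · exact isPreconnected_Ioo.intermediate_value_Iio hleft hright hZcont hbot hlim
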